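/- Let A be an integral domain that is a finitely generated algebra over a field k. Then there exists a nonzero element f ∈ A such that the localization A_f = A[1/f] is integrally closed in its fraction field (i.e., A_f is a normal domain). -/

import Mathlib

open Polynomial in
/-- If `a` is algebraic over a field of exponential characteristic `p`, then `a ^ p ^ n` is
separable for all large `n`. -/
theorem IsAlgebraic.exists_forall_isSeparable_pow {K Ω : Type*} [Field K] [Field Ω] [Algebra K Ω]
    (p : ℕ) [ExpChar K p] {a : Ω} (ha : IsAlgebraic K a) :
    ∃ m, ∀ n, m ≤ n → IsSeparable K (a ^ p ^ n) := by
  have := expChar_of_injective_algebraMap (algebraMap K Ω).injective p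
  obtain ⟨g, hg, m, hm⟩ := (minpoly.irreducible ha.isIntegral).hasSeparableContraction p
  refine ⟨m, fun n hn ↦ ?_⟩
  obtain ⟨j, rfl⟩ := Nat.exists_eq_add_of_le hn
  refine (hg.map (f := iterateFrobenius K p j)).of_dvd (minpoly.dvd _ _ ?_)
  have h : aeval (a ^ p ^ m) g = 0 := by
    simpa only [expand_aeval, minpoly.aeval] using congr_arg (aeval a) hm
  have hc : (algebraMap K Ω).comp (iterateFrobenius K p j) =
      (iterateFrobenius Ω p j).comp (algebraMap K Ω) := by
    ext; simp [iterateFrobenius_def]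
  rw [pow_add, pow_mul, ← iterateFrobenius_def p j, aeval_def, eval₂_map, hc, ← hom_eval₂,
    ← aeval_def, h, map_zero]

/-- Let `R'` be a noetherian normal domain with fraction field `K'`, finite over a ring `R`.
The elements integral over `R` in a finite separable extension `K'(S)` of `K'` all lie in
a finite `R`-module. -/
theorem exists_fg_of_isIntegral_mem_adjoin {R R' K' Ω : Type*} [CommRing R] [CommRing R']
    [IsDomain R'] [IsIntegrallyClosed R'] [IsNoetherianRing R'] [Field K'] [Field Ω]
    [Algebra R' K'] [IsFractionRing R' K'] [Algebra K' Ω] [Algebra R' Ω] [IsScalarTower R' K' Ω]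
    [Algebra R Ω] (f : R →+* R') (hf : f.Finite)
    (hfΩ : (algebraMap R' Ω).comp f = algebraMap R Ω)
    {S : Set Ω} (hS : S.Finite) (hsep : ∀ a ∈ S, IsSeparable K' a) :
    ∃ N : Submodule R Ω, N.FG ∧
      ∀ z ∈ IntermediateField.adjoin K' S, IsIntegral R z → z ∈ N := by
  algebraize [f]
  have : IsScalarTower R R' Ω := .of_algebraMap_eq' hfΩ.symm
  set E := IntermediateField.adjoin K' S with hE
  have : Finite S := hS
  have : FiniteDimensional K' E :=
    IntermediateField.finiteDimensional_adjoin fun a ha ↦ (hsep a ha).isIntegral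
  have : Algebra.IsSeparable K' E :=
    (IntermediateField.isSeparable_adjoin_iff_isSeparable K' Ω).2 hsep
  have hfin : Module.Finite R' (integralClosure R' E) :=
    IsIntegralClosure.finite R' K' E (integralClosure R' E)
  have : IsScalarTower R' E Ω := .of_algebraMap_eq fun _ ↦ rfl
  let φ : integralClosure R' E →ₗ[R'] Ω :=
    (IsScalarTower.toAlgHom R' E Ω).toLinearMap ∘ₗ (integralClosure R' E).val.toLinearMap
  have : Module.Finite R (LinearMap.range φ) := Module.Finite.trans R' _
  refine ⟨(LinearMap.range φ).restrictScalars R, Module.Finite.iff_fg.1 this, fun z hz hzi ↦ ?_⟩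
  have hz' : IsIntegral R' z := hzi.tower_top
  exact ⟨⟨⟨z, hz⟩, (isIntegral_algHom_iff (IsScalarTower.toAlgHom R' E Ω)
    (algebraMap E Ω).injective).1 hz'⟩, rfl⟩

/-- A domain with fraction field `L` whose normalization is finite becomes normal after
inverting a suitable nonzero element. -/
theorem exists_localization_away_isIntegrallyClosed_of_finite (A L : Type*) [CommRing A]
    [IsDomain A] [Field L] [Algebra A L] [IsFractionRing A L]
    [Module.Finite A (integralClosure A L)] :
    ∃ f : A, f ≠ 0 ∧ IsIntegrallyClosed (Localization.Away f) := by
  obtain ⟨s, hs⟩ : (integralClosure A L).toSubmodule.FG := Module.Finite.iff_fg.1 ‹_›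
  obtain ⟨⟨f, hf⟩, hfs⟩ := IsLocalization.exist_integer_multiples_of_finset (nonZeroDivisors A) s
  have key (z : L) (hz : IsIntegral A z) : f • z ∈ LinearMap.range (Algebra.linearMap A L) := by
    have hle : Submodule.span A (s : Set L) ≤
        (LinearMap.range (Algebra.linearMap A L)).comap (LinearMap.lsmul A L f) :=
      Submodule.span_le.2 hfs
    exact hle (hs ▸ hz)
  refine ⟨f, nonZeroDivisors.ne_zero hf, ?_⟩
  have hle := powers_le_nonZeroDivisors_of_noZeroDivisors (nonZeroDivisors.ne_zero hf)
  let _ : Algebra (Localization.Away f) L :=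
    IsLocalization.localizationAlgebraOfSubmonoidLe _ _ (Submonoid.powers f) _ hle
  have : IsScalarTower A (Localization.Away f) L :=
    IsLocalization.localization_isScalarTower_of_submonoid_le ..
  have := IsFractionRing.isFractionRing_of_isDomain_of_isLocalization (Submonoid.powers f)
    (Localization.Away f) L
  refine (isIntegrallyClosed_iff L).2 fun {z} hz ↦ ?_
  obtain ⟨⟨_, n, rfl⟩, hn⟩ :=
    hz.exists_multiple_integral_of_isLocalization (Submonoid.powers f)
  obtain ⟨b, hb⟩ := key _ hn
  refine ⟨IsLocalization.mk' _ b (⟨f ^ (n + 1), n + 1, rfl⟩ : Submonoid.powers f), ?_⟩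
  have hf0 : algebraMap A L f ≠ 0 := by simpa using nonZeroDivisors.ne_zero hf
  have hspec := congr_arg (algebraMap (Localization.Away f) L)
    (IsLocalization.mk'_spec (Localization.Away f) b
      (⟨f ^ (n + 1), n + 1, rfl⟩ : Submonoid.powers f))
  rw [map_mul, ← IsScalarTower.algebraMap_apply, ← IsScalarTower.algebraMap_apply] at hspec
  refine mul_right_cancel₀ (pow_ne_zero (n + 1) hf0) ?_
  rw [← map_pow, hspec]
  refine hb.trans ?_
  simp only [Submonoid.smul_def, Algebra.smul_def, map_pow]
  ring

/-- Over an algebraically closed field, finitely many `p ^ n`-th roots of elements of `k` and of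
algebraically independent variables generate a finite extension of the polynomial ring which is
again a polynomial ring. -/
theorem exists_intermediateField_algebraicIndependent_roots {k Ω ι : Type*} [Field k] [Field Ω]
    [Algebra k Ω] [IsAlgClosed Ω] (p : ℕ) [ExpChar Ω p] (n : ℕ) {x : ι → Ω}
    (hx : AlgebraicIndependent k x) {R : Set k} (hR : R.Finite) :
    ∃ k' : IntermediateField k Ω, FiniteDimensional k k' ∧
      (∀ r ∈ R, (iterateFrobeniusEquiv Ω p n).symm (algebraMap k Ω r) ∈ k') ∧
      AlgebraicIndependent k' fun i ↦ (iterateFrobeniusEquiv Ω p n).symm (x i) := by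
  set φ := (iterateFrobeniusEquiv Ω p n).symm with hφ
  have hpow (z : Ω) : φ z ^ p ^ n = z := by
    rw [← iterateFrobenius_def, ← coe_iterateFrobeniusEquiv, hφ, RingEquiv.apply_symm_apply]
  set S := (fun r ↦ φ (algebraMap k Ω r)) '' R
  have : Finite S := hR.image _
  have hfin : FiniteDimensional k (IntermediateField.adjoin k S) := by
    refine IntermediateField.finiteDimensional_adjoin ?_
    rintro _ ⟨r, -, rfl⟩
    refine .of_pow (expChar_pow_pos Ω p n) ?_
    rw [hpow]
    exact isIntegral_algebraMap
  refine ⟨_, hfin, fun r hr ↦ IntermediateField.subset_adjoin _ _ ⟨r, hr, rfl⟩, ?_⟩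
  set k' := IntermediateField.adjoin k S
  have : ExpChar k' p := (algebraMap k' Ω).expChar (algebraMap k' Ω).injective p
  refine AlgebraicIndependent.of_ringHom_of_comp_eq (iterateFrobenius k' p n)
    (iterateFrobenius Ω p n) ?_ (iterateFrobenius k' p n).injective ?_
  · convert hx.extendScalars k' using 1
    ext i
    simp [iterateFrobenius_def, hpow]
  · ext; simp [iterateFrobenius_def]

open Polynomial in
/-- If a ring endomorphism `φ` of `Ω` sends the coefficients of the minimal polynomial over `K` of
a separable element `a` into `K'`, then `φ a` is separable over `K'`. -/
theorem IsSeparable.map_of_coeff_mem_range {K K' Ω : Type*} [Field K] [Field K'] [Field Ω]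
    [Algebra K Ω] [Algebra K' Ω] (φ : Ω →+* Ω) {a : Ω} (ha : IsSeparable K a)
    (h : ∀ i, φ (algebraMap K Ω ((minpoly K a).coeff i)) ∈ (algebraMap K' Ω).range) :
    IsSeparable K' (φ a) := by
  obtain ⟨g, hg⟩ := (lifts_iff_coeff_lifts (f := algebraMap K' Ω)
    ((minpoly K a).map (φ.comp (algebraMap K Ω)))).2 fun i ↦ by simpa using h i
  replace hg : g.map (algebraMap K' Ω) = _ := hg
  have hsep : g.Separable := by
    rw [← separable_map (algebraMap K' Ω), hg]
    exact Polynomial.Separable.map ha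
  refine hsep.of_dvd (minpoly.dvd _ _ ?_)
  rw [aeval_def, ← eval_map, hg, eval_map, ← hom_eval₂, ← aeval_def, minpoly.aeval, map_zero]

/-- Finitely many elements algebraic over `k[x]` lie in a field extension of `k(x)` in which the
integral elements over `k[x]` are contained in a finite `k[x]`-module. -/
theorem MvPolynomial.exists_fg_of_isIntegral {k Ω ι : Type*} [Field k] [Field Ω] [IsAlgClosed Ω]
    [Finite ι] [Algebra (MvPolynomial ι k) Ω] [FaithfulSMul (MvPolynomial ι k) Ω]
    {S : Set Ω} (hS : S.Finite) (halg : ∀ a ∈ S, IsAlgebraic (MvPolynomial ι k) a) :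
    ∃ (E : Subfield Ω) (N : Submodule (MvPolynomial ι k) Ω), S ⊆ E ∧
      (∀ b, algebraMap (MvPolynomial ι k) Ω b ∈ E) ∧ N.FG ∧
      ∀ z ∈ E, IsIntegral (MvPolynomial ι k) z → z ∈ N := by
  let _ : Algebra k Ω := ((algebraMap (MvPolynomial ι k) Ω).comp (algebraMap k _)).toAlgebra
  have : IsScalarTower k (MvPolynomial ι k) Ω := .of_algebraMap_eq' rfl
  set B := MvPolynomial ι k
  let K := FractionRing B
  let _ : Algebra K Ω := FractionRing.liftAlgebra B Ω
  set p := ringExpChar k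
  have : ExpChar Ω p := expChar_of_injective_algebraMap (algebraMap k Ω).injective p
  have : ExpChar K p := expChar_of_injective_algebraMap (algebraMap k K).injective p
  set x : ι → Ω := fun i ↦ algebraMap B Ω (X i)
  have hxB (b : B) : aeval x b = algebraMap B Ω b := by
    have : aeval x = IsScalarTower.toAlgHom k B Ω := by
      ext i; rw [aeval_X]; rfl
    rw [this]; rfl
  have hx : AlgebraicIndependent k x := by
    rw [algebraicIndependent_iff_injective_aeval]
    intro b c h
    rw [hxB, hxB] at h
    exact FaithfulSMul.algebraMap_injective B Ω h
  obtain ⟨n, hn⟩ : ∃ n, ∀ a ∈ S, IsSeparable K (a ^ p ^ n) := by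
    choose! m hm using fun a (ha : a ∈ S) ↦
      (halg a ha).extendScalars (S := K) (FaithfulSMul.algebraMap_injective B K)
        |>.exists_forall_isSeparable_pow p
    obtain ⟨n, hn⟩ := (hS.image m).bddAbove
    exact ⟨n, fun a ha ↦ hm a ha n (hn ⟨a, ha, rfl⟩)⟩
  set φ := (iterateFrobeniusEquiv Ω p n).symm with hφ
  have hpow (z : Ω) : φ z ^ p ^ n = z := by
    rw [← iterateFrobenius_def, ← coe_iterateFrobeniusEquiv, hφ, RingEquiv.apply_symm_apply]
  have hpow' (z : Ω) : φ (z ^ p ^ n) = z := by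
    rw [← iterateFrobenius_def, ← coe_iterateFrobeniusEquiv, hφ, RingEquiv.symm_apply_apply]
  let c : Set K := ⋃ a ∈ S, ((minpoly K (a ^ p ^ n)).coeffs : Set K)
  have hc : c.Finite := hS.biUnion fun a _ ↦ Finset.finite_toSet _
  let R : Set k := ⋃ z ∈ c, ((IsLocalization.sec (nonZeroDivisors B) z).1.coeffs : Set k) ∪
    ((IsLocalization.sec (nonZeroDivisors B) z).2 : B).coeffs
  have hcR {z : K} (hz : z ∈ c) := Set.subset_biUnion_of_mem
    (u := fun z ↦ ((IsLocalization.sec (nonZeroDivisors B) z).1.coeffs : Set k) ∪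
      ((IsLocalization.sec (nonZeroDivisors B) z).2 : B).coeffs) hz
  have hR : R.Finite := hc.biUnion fun a _ ↦ (Finset.finite_toSet _).union (Finset.finite_toSet _)
  obtain ⟨k', hk', hRk', hy⟩ := exists_intermediateField_algebraicIndependent_roots p n hx hR
  let y : ι → Ω := fun i ↦ φ (x i)
  set B' := MvPolynomial ι k'
  let _ : Algebra B' Ω := (aeval (R := k') y).toAlgebra
  have hB' (b : B') : algebraMap B' Ω b = aeval y b := rfl
  have : FaithfulSMul B' Ω := (faithfulSMul_iff_algebraMap_injective _ _).2 hy
  have : IsIntegrallyClosed B' := UniqueFactorizationMonoid.instIsIntegrallyClosed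
  let K' := FractionRing B'
  let _ : Algebra K' Ω := FractionRing.liftAlgebra B' Ω
  have hφB (b : B) (hb : (b.coeffs : Set k) ⊆ R) :
      φ (algebraMap B Ω b) ∈ (algebraMap B' Ω).range := by
    rw [← hxB, aeval_def, ← RingEquiv.coe_toRingHom, eval₂_comp_left]
    refine eval₂_mem (fun i hi ↦ ?_) fun i ↦ ⟨X i, ?_⟩
    · exact ⟨C ⟨_, hRk' _ (hb (coeff_mem_coeffs i (mem_support_iff.1 hi)))⟩,
        by rw [hB', aeval_C]; rfl⟩
    · rw [hB', aeval_X]; rfl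
  have hφc (z : K) (hz : z ∈ c) : φ (algebraMap K Ω z) ∈ (algebraMap K' Ω).range := by
    set w := IsLocalization.sec (nonZeroDivisors B) z
    have hw : z = algebraMap B K w.1 / algebraMap B K w.2 := by
      rw [eq_div_iff (IsFractionRing.to_map_ne_zero_of_mem_nonZeroDivisors w.2.2)]
      exact IsLocalization.sec_spec _ z
    obtain ⟨u, hu⟩ := hφB w.1 (Set.subset_union_left.trans (hcR hz))
    obtain ⟨v, hv⟩ := hφB w.2 (Set.subset_union_right.trans (hcR hz))
    refine ⟨algebraMap B' K' u / algebraMap B' K' v, ?_⟩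
    rw [hw, map_div₀, map_div₀, map_div₀, ← IsScalarTower.algebraMap_apply,
      ← IsScalarTower.algebraMap_apply, ← IsScalarTower.algebraMap_apply,
      ← IsScalarTower.algebraMap_apply, hu, hv]
  let f : B →+* B' := eval₂Hom (C.comp (algebraMap k k')) fun i ↦ X i ^ p ^ n
  have hfΩ : (algebraMap B' Ω).comp f = algebraMap B Ω := by
    refine ringHom_ext (fun r ↦ ?_) fun i ↦ ?_
    · simp only [f, RingHom.comp_apply, eval₂Hom_C, hB', aeval_C]; rfl
    · simp only [f, RingHom.comp_apply, eval₂Hom_X', map_pow, hB', aeval_X]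
      exact hpow _
  have hf : f.Finite := by
    have hfC : f.comp C = algebraMap k B' := RingHom.ext fun r ↦ eval₂Hom_C _ _ _
    refine RingHom.IsIntegral.to_finite (fun b ↦ ?_) (RingHom.FiniteType.of_comp_finiteType
      (f := (C : k →+* B)) ?_)
    · algebraize [f]
      change IsIntegral B b
      induction b using MvPolynomial.induction_on with
      | C r =>
        have : IsScalarTower k B B' := .of_algebraMap_eq' hfC.symm
        exact ((Algebra.IsIntegral.isIntegral (R := k) r).algebraMap (B := B')).tower_top
      | add b c hb hc => exact hb.add hc
      | mul_X b i hb =>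
        refine hb.mul (.of_pow (expChar_pow_pos Ω p n) ?_)
        have hXi : algebraMap B B' (X i) = X i ^ p ^ n := eval₂Hom_X' _ _ _
        exact hXi ▸ isIntegral_algebraMap
    · rw [hfC, RingHom.finiteType_algebraMap]
      exact Algebra.FiniteType.trans (S := k') inferInstance inferInstance
  have hsep (a : Ω) (ha : a ∈ S) : IsSeparable K' a := by
    rw [← hpow' a]
    refine (hn a ha).map_of_coeff_mem_range (φ : Ω →+* Ω) fun i ↦ ?_
    by_cases hi : (minpoly K (a ^ p ^ n)).coeff i = 0
    · simp [hi]
    · exact hφc _ (Set.mem_biUnion ha (Polynomial.coeff_mem_coeffs hi))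
  obtain ⟨N, hN, hmem⟩ := exists_fg_of_isIntegral_mem_adjoin (K' := K') f hf hfΩ hS hsep
  refine ⟨(IntermediateField.adjoin K' S).toSubfield, N, IntermediateField.subset_adjoin _ _,
    fun b ↦ ?_, hN, hmem⟩
  rw [← hfΩ, RingHom.comp_apply, IsScalarTower.algebraMap_apply B' K' Ω]
  exact (IntermediateField.adjoin K' S).algebraMap_mem _

/-- The normalization of a domain of finite type over a field is finite. -/
theorem finite_integralClosure_of_finiteType (k A L : Type*) [Field k] [CommRing A] [IsDomain A]
    [Algebra k A] [Algebra.FiniteType k A] [Field L] [Algebra A L] [IsFractionRing A L] :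
    Module.Finite A (integralClosure A L) := by
  obtain ⟨s, g, hg, hgf⟩ := exists_finite_inj_algHom_of_fg k A
  set B := MvPolynomial (Fin s) k
  algebraize [g.toRingHom]
  have : Module.Finite B A := hgf
  let Ω := AlgebraicClosure L
  let _ : Algebra B L := ((algebraMap A L).comp (algebraMap B A)).toAlgebra
  have : IsScalarTower B A L := .of_algebraMap_eq' rfl
  have : FaithfulSMul B Ω := (faithfulSMul_iff_algebraMap_injective _ _).2
    ((algebraMap L Ω).injective.comp ((IsFractionRing.injective A L).comp hg))
  obtain ⟨t, ht⟩ := Module.Finite.fg_top (R := B) (M := A)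
  obtain ⟨E, N, hSE, hBE, hN, hmem⟩ := MvPolynomial.exists_fg_of_isIntegral
    (S := (fun a ↦ algebraMap L Ω (algebraMap A L a)) '' t) (t.finite_toSet.image _) (by
      rintro _ ⟨a, -, rfl⟩
      exact (((Algebra.IsIntegral.isIntegral (R := B) a).algebraMap (B := L)).algebraMap
        (B := Ω)).isAlgebraic)
  have hAE (a : A) : algebraMap L Ω (algebraMap A L a) ∈ E := by
    have ha : a ∈ Submodule.span B (t : Set A) := ht ▸ Submodule.mem_top
    induction ha using Submodule.span_induction with
    | mem x hx => exact hSE ⟨x, hx, rfl⟩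
    | zero => simp
    | add x y _ _ hx hy => simpa using add_mem hx hy
    | smul b x _ hx =>
      rw [Algebra.smul_def, map_mul, map_mul]
      exact mul_mem (hBE b) hx
  have hLE (z : L) : algebraMap L Ω z ∈ E := by
    obtain ⟨a, b, -, rfl⟩ := IsFractionRing.div_surjective (A := A) z
    rw [map_div₀]
    exact div_mem (hAE a) (hAE b)
  let ψ : integralClosure A L →ₗ[B] N :=
    ((IsScalarTower.toAlgHom B L Ω).toLinearMap ∘ₗ
      (integralClosure A L).val.toLinearMap.restrictScalars B).codRestrict N fun z ↦
        hmem _ (hLE z) (isIntegral_trans (R := B) _ z.2).algebraMap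
  have : Module.Finite B N := Module.Finite.iff_fg.2 hN
  have : Module.Finite B (integralClosure A L) := Module.Finite.of_injective ψ fun z w h ↦
    Subtype.ext ((algebraMap L Ω).injective (congr_arg Subtype.val h))
  exact Module.Finite.of_restrictScalars_finite B A _


/-- A domain of finite type over a field admits a nonzero `f` such that the
localization `A_f` is integrally closed (normal). -/
theorem exists_localization_away_integrallyClosed
    (k A : Type*) [Field k] [CommRing A] [IsDomain A] [Algebra k A]
    [Algebra.FiniteType k A] :
    ∃ f : A, f ≠ 0 ∧ IsIntegrallyClosed (Localization.Away f) := by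
  have := finite_integralClosure_of_finiteType k A (FractionRing A)
  exact exists_localization_away_isIntegrallyClosed_of_finite A (FractionRing A)
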